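/- arXiv:1407.4784 — 2 statements merged into one kernel-verified Lean document; each statement's English description precedes it below -/
import Mathlib

section
/- For n = 3 and k = 4: for every family of sets S_{ij} ⊆ ℕ with |S_{ij}| = 4 (i = 1,2,3,4; j ∈ ℕ), there exist a_{ij} ∈ S_{ij} such that (2a) a_{i1}, a_{i2}, a_{i3} are pairwise distinct for each i; (2b) a_{ij} ∉ {a_{i1}, a_{i2}} for all j ≥ 3; and (3) for all distinct rows r₁ ≠ r₂ and all j ∈ ℕ, {a_{r₁1},…,a_{r₁j}} ≠ {a_{r₂1},…,a_{r₂j}}. -/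
namespace GF

/-- Binary search trees of naturals, used as a lookup table. -/
inductive Tr where
  | lf : Tr
  | nd : Tr → ℕ → Tr → Tr

def Tr.mem : Tr → ℕ → Bool
  | .lf, _ => false
  | .nd l k r, c => bif Nat.beq c k then true else bif Nat.ble c k then l.mem c else r.mem c

def Tr.toList : Tr → List ℕ
  | .lf => []
  | .nd l k r => l.toList ++ k :: r.toList

theorem Tr.mem_toList : ∀ (t : Tr) (c : ℕ), t.mem c = true → c ∈ t.toList
  | .lf, _, h => by simp [Tr.mem] at h
  | .nd l k r, c, h => by
    have h1 := Tr.mem_toList l c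
    have h2 := Tr.mem_toList r c
    simp only [Tr.mem, Tr.toList, List.mem_append, List.mem_cons] at *
    cases hb : Nat.beq c k
    · rw [hb] at h
      cases hc : Nat.ble c k
      · rw [hc] at h; exact Or.inr (Or.inr (h2 h))
      · rw [hc] at h; exact Or.inl (h1 h)
    · exact Or.inr (Or.inl (Nat.eq_of_beq_eq_true hb))

/-- The sporadic losing positions. A position is coded in base 8; digit number `m` is the
(capped) number of elements lying in exactly the rows listed by the bit mask `m`. -/
def exc : Tr :=
  (.nd (.nd (.nd (.nd (.nd (.nd (.nd .lf 4680 .lf) 8712 (.nd .lf 8768 .lf)) 32904 (.nd (.nd .lf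
  33344 .lf) 36936 (.nd .lf 36992 .lf))) 37376 (.nd (.nd (.nd .lf 37440 .lf) 262224 (.nd .lf
  262664 .lf)) 266256 (.nd (.nd .lf 266312 .lf) 266752 (.nd .lf 266760 .lf)))) 294920 (.nd (.nd
  (.nd (.nd .lf 294976 .lf) 294984 (.nd .lf 295424 .lf)) 16777800 (.nd (.nd .lf 16781384 .lf)
  16781832 (.nd .lf 16781888 .lf))) 16810056 (.nd (.nd (.nd .lf 16810496 .lf) 16814088 (.nd .lf
  16814144 .lf)) 17039432 (.nd (.nd .lf 17039872 .lf) 17043464 (.nd .lf 17043520 .lf)))))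
  17072128 (.nd (.nd (.nd (.nd (.nd .lf 33554952 .lf) 33555008 (.nd .lf 33587208 .lf)) 33591296
  (.nd (.nd .lf 33816640 .lf) 33820672 (.nd .lf 134217864 .lf))) 134218304 (.nd (.nd (.nd .lf
  134221896 .lf) 134222336 (.nd .lf 134225928 .lf)) 134250560 (.nd (.nd .lf 134254592 .lf)
  134479944 (.nd .lf 134480384 .lf)))) 134483976 (.nd (.nd (.nd (.nd .lf 134512640 .lf)
  150995016 (.nd .lf 150995072 .lf)) 150995456 (.nd (.nd .lf 150995520 .lf) 150999048 (.nd .lf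
  150999104 .lf))) 151003136 (.nd (.nd (.nd .lf 151027712 .lf) 151031808 (.nd .lf 151257152
  .lf)) 151261184 (.nd (.nd .lf 1073741904 .lf) 1073742344 .lf))))) 1073745992 (.nd (.nd (.nd
  (.nd (.nd (.nd .lf 1073746432 .lf) 1073750080 (.nd .lf 1073774664 .lf)) 1073775104 (.nd (.nd
  .lf 1073778752 .lf) 1074003976 (.nd .lf 1074008064 .lf))) 1074036736 (.nd (.nd (.nd .lf
  1090519056 .lf) 1090519112 (.nd .lf 1090519552 .lf)) 1090519560 (.nd (.nd .lf 1090523144 .lf)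
  1090523200 (.nd .lf 1090527232 .lf)))) 1090551816 (.nd (.nd (.nd (.nd .lf 1090555904 .lf)
  1090781184 (.nd .lf 1090785280 .lf)) 1207959560 (.nd (.nd .lf 1207959616 .lf) 1207959624 (.nd
  .lf 1207960064 .lf))) 1207963648 (.nd (.nd (.nd .lf 1207992320 .lf) 1208221696 (.nd .lf
  68719480848 .lf)) 68719480904 (.nd (.nd .lf 68719480960 .lf) 68719481352 (.nd .lf 68719481408
  .lf))))) 68719509512 (.nd (.nd (.nd (.nd (.nd .lf 68719509568 .lf) 68719510016 (.nd .lf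
  68719738888 .lf)) 68719738944 (.nd (.nd .lf 68719739392 .lf) 68736253968 (.nd .lf 68736254024
  .lf))) 68736254080 (.nd (.nd (.nd .lf 68736254472 .lf) 68736254528 (.nd .lf 68736258056 .lf))
  68736258112 (.nd (.nd .lf 68736286720 .lf) 68736286728 (.nd .lf 68736516096 .lf))))
  68736516160 (.nd (.nd (.nd (.nd .lf 68853694472 .lf) 68853694528 (.nd .lf 68853694976 .lf))
  68853698560 (.nd (.nd .lf 68853698568 .lf) 68853727232 (.nd .lf 68853956608 .lf))) 69793218568
  (.nd (.nd (.nd .lf 69793218624 .lf) 69793219072 (.nd .lf 69793222656 .lf)) 69793222720 (.nd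
  (.nd .lf 69793251328 .lf) 69793480704 .lf))))))
def ch0 : Tr :=
  (.nd (.nd (.nd (.nd .lf 4160 .lf) 4608 (.nd .lf 32832 .lf)) 33280 (.nd (.nd .lf 16777280 .lf)
  16777728 .lf)) 16781312 (.nd (.nd (.nd .lf 16809984 .lf) 134217792 .lf) 134218240 (.nd (.nd
  .lf 134221824 .lf) 134250496 .lf)))

def ch1 : Tr :=
  (.nd (.nd (.nd (.nd .lf 4104 .lf) 4608 (.nd .lf 262152 .lf)) 262656 (.nd (.nd .lf 16777224
  .lf) 16777728 .lf)) 16781312 (.nd (.nd (.nd .lf 17039360 .lf) 1073741832 .lf) 1073742336 (.nd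
  (.nd .lf 1073745920 .lf) 1074003968 .lf)))

def ch2 : Tr :=
  (.nd (.nd (.nd (.nd .lf 72 .lf) 32832 (.nd .lf 262152 .lf)) 294912 (.nd (.nd .lf 16777224 .lf)
  16777280 .lf)) 16809984 (.nd (.nd (.nd .lf 17039360 .lf) 68719476744 .lf) 68719476800 (.nd
  (.nd .lf 68719509504 .lf) 68719738880 .lf)))

def ch3 : Tr :=
  (.nd (.nd (.nd (.nd .lf 72 .lf) 4104 (.nd .lf 4160 .lf)) 134217792 (.nd (.nd .lf 134221824
  .lf) 1073741832 .lf)) 1073745920 (.nd (.nd (.nd .lf 1207959552 .lf) 68719476744 .lf)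
  68719476800 (.nd (.nd .lf 68853694464 .lf) 69793218560 .lf)))


def dig (c m : ℕ) : ℕ := Nat.mod (Nat.div c (Nat.pow 8 m)) 8

/-- Evaluate the argument first (makes kernel reduction efficient). -/
def frc (n : ℕ) (f : ℕ → Bool) : Bool :=
  match n with
  | 0 => f 0
  | k + 1 => f (Nat.succ k)

theorem frc_eq (n : ℕ) (f : ℕ → Bool) : frc n f = f n := by cases n <;> rfl

def rst (c a b : ℕ) : ℕ :=
  Nat.add (Nat.mul (dig c a) (Nat.pow 8 a)) (Nat.mul (dig c b) (Nat.pow 8 b))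

/-- Three rows `C, C + a, C + b`, with the fourth row ignored. -/
def isCh (c a b : ℕ) (T : Tr) : Bool :=
  frc (rst c a b) fun d => frc (Nat.sub c d) fun r =>
    Nat.beq (Nat.mod r 7) 2 && (T.mem r && Nat.beq c (Nat.add r d))

def isEq (c : ℕ) (l : List ℕ) : Bool := l.all fun m => Nat.beq (dig c m) 0

def anyEq (c : ℕ) : Bool :=
  isEq c [1, 2, 5, 6, 9, 10, 13, 14] || isEq c [1, 3, 4, 6, 9, 11, 12, 14] ||
  isEq c [1, 3, 5, 7, 8, 10, 12, 14] || isEq c [2, 3, 4, 5, 10, 11, 12, 13] ||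
  isEq c [2, 3, 6, 7, 8, 9, 12, 13] || isEq c [4, 5, 6, 7, 8, 9, 10, 11]

def anyCh (c : ℕ) : Bool :=
  isCh c 1 14 ch0 || isCh c 2 13 ch1 || isCh c 4 11 ch2 || isCh c 8 7 ch3

def isExc (c : ℕ) : Bool :=
  frc (Nat.mod c 7) fun d => (Nat.beq d 3 || Nat.beq d 4) && exc.mem c

def bad (c : ℕ) : Bool := isExc c || anyCh c || anyEq c

def BLc (a b : ℕ) (T : Tr) : List ℕ :=
  T.toList.flatMap fun r => [0, 1, 2, 3].flatMap fun p => [0, 1, 2, 3].map fun q =>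
    Nat.add r (Nat.add (Nat.mul p (Nat.pow 8 a)) (Nat.mul q (Nat.pow 8 b)))

def BL : List ℕ :=
  exc.toList ++ (BLc 1 14 ch0 ++ (BLc 2 13 ch1 ++ (BLc 4 11 ch2 ++ BLc 8 7 ch3)))

/-- All possible successors of `c` when a row gets an element of mask `t`, the mask
becoming `u`. The last argument is the continuation. -/
def succs (c t u t2 : ℕ) (k : ℕ → Bool) : Bool :=
  frc (dig c t) fun dt => frc (dig c u) fun du =>
  bif (bif Nat.beq t 0 then true else
      bif Nat.beq t t2 then Nat.ble 2 dt else Nat.ble 1 dt) then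
    frc (bif Nat.beq u 15 then c else bif Nat.beq du 3 then c else Nat.add c (Nat.pow 8 u)) fun c' =>
    (bif Nat.beq t 0 then k c' else
      k (Nat.sub c' (Nat.pow 8 t)) && (bif Nat.beq dt 3 then k c' else true))
  else true

/-- All possible predecessors. -/
def preds (c t u : ℕ) (k : ℕ → Bool) : Bool :=
  frc (dig c t) fun dt => frc (dig c u) fun du =>
  (bif Nat.beq u 15 then predsB c dt t k else
    (bif Nat.beq du 3 then predsB c dt t k else true) &&
    (bif Nat.beq du 0 then true else predsB (Nat.sub c (Nat.pow 8 u)) dt t k))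
where
  predsB (c dt t : ℕ) (k : ℕ → Bool) : Bool :=
    bif Nat.beq t 0 then frc c k else
      bif Nat.beq dt 3 then frc c k else frc (Nat.add c (Nat.pow 8 t)) k

def tl : ℕ → List ℕ
  | 0 => [0, 2, 4, 6, 8, 10, 12, 14]
  | 1 => [0, 1, 4, 5, 8, 9, 12, 13]
  | 2 => [0, 1, 2, 3, 8, 9, 10, 11]
  | _ => [0, 1, 2, 3, 4, 5, 6, 7]

def chkS (c b : ℕ) (l : List ℕ) (t2 : ℕ) : Bool :=
  l.all fun t => succs c t (Nat.add t b) t2 fun c' => frc c' fun c' => !bad c'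

def chkP (c2 b : ℕ) (l : List ℕ) : Bool :=
  l.all fun t2 => preds c2 t2 (Nat.add t2 b) fun c => bad c || chkS c b l t2

def chk (c2 : ℕ) : Bool := frc c2 fun c2 =>
  chkP c2 1 (tl 0) && (chkP c2 2 (tl 1) && (chkP c2 4 (tl 2) && chkP c2 8 (tl 3)))

theorem chk_all : BL.all chk = true := by
  decide +kernel

def rsum (c i : ℕ) : ℕ := ((List.range 16).map fun m => bif m.testBit i then dig c m else 0).sum

theorem rsum_all : (BL.all fun c => !(Nat.beq (rsum c 0) (rsum c 1) && Nat.beq (rsum c 0) (rsum c 2)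
    && Nat.beq (rsum c 0) (rsum c 3)) || Nat.beq c (8 + 8 ^ 2 + 8 ^ 4 + 8 ^ 8)) = true := by
  decide +kernel


open Finset

def msk (A : Fin 4 → Finset ℕ) (z : ℕ) : ℕ := ∑ i : Fin 4, if z ∈ A i then 2 ^ (i : ℕ) else 0

def cnt (A : Fin 4 → Finset ℕ) (m : ℕ) : ℕ := ((univ.biUnion A).filter (fun z => msk A z = m)).card

def fA (A : Fin 4 → Finset ℕ) (m : ℕ) : ℕ := if m = 0 ∨ m = 15 then 0 else min (cnt A m) 3

def code (f : ℕ → ℕ) : ℕ := ∑ m ∈ range 16, f m * 8 ^ m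

def Bad (A : Fin 4 → Finset ℕ) : Prop := bad (code (fA A)) = true

theorem fA_le (A : Fin 4 → Finset ℕ) (m : ℕ) : fA A m ≤ 3 := by
  unfold fA; split_ifs <;> omega

theorem dig_code (f : ℕ → ℕ) (hf : ∀ m, f m ≤ 3) (k : ℕ) (hk : k < 16) : dig (code f) k = f k := by
  have h0 := hf 0
  have h1 := hf 1
  have h2 := hf 2
  have h3 := hf 3
  have h4 := hf 4
  have h5 := hf 5
  have h6 := hf 6
  have h7 := hf 7
  have h8 := hf 8
  have h9 := hf 9
  have h10 := hf 10
  have h11 := hf 11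
  have h12 := hf 12
  have h13 := hf 13
  have h14 := hf 14
  have h15 := hf 15
  change code f / 8 ^ k % 8 = f k
  simp only [code, Finset.sum_range_succ, Finset.sum_range_zero]
  interval_cases k <;> norm_num only <;> omega

theorem msk_lt (A : Fin 4 → Finset ℕ) (z : ℕ) : msk A z < 16 := by
  simp only [msk, Fin.sum_univ_four]
  split_ifs <;> simp

theorem msk_bit (A : Fin 4 → Finset ℕ) (z : ℕ) (i : Fin 4) :
    (msk A z).testBit i = decide (z ∈ A i) := by
  simp only [msk, Fin.sum_univ_four]
  by_cases h0 : z ∈ A 0 <;> by_cases h1 : z ∈ A 1 <;> by_cases h2 : z ∈ A 2 <;>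
    by_cases h3 : z ∈ A 3 <;> fin_cases i <;> simp [h0, h1, h2, h3] <;> decide

theorem cnt_eq (A : Fin 4 → Finset ℕ) (m : ℕ) (hm : m ≠ 0) (U : Finset ℕ)
    (hU : univ.biUnion A ⊆ U) : cnt A m = (U.filter (fun z => msk A z = m)).card := by
  unfold cnt
  congr 1
  apply Finset.Subset.antisymm
  · exact Finset.filter_subset_filter _ hU
  · intro z hz
    simp only [Finset.mem_filter] at hz ⊢
    refine ⟨?_, hz.2⟩
    by_contra h
    simp only [Finset.mem_biUnion, Finset.mem_univ, true_and, not_exists] at h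
    apply hm
    rw [← hz.2]
    simp [msk, h]

def upd (A : Fin 4 → Finset ℕ) (s : Fin 4) (x : ℕ) : Fin 4 → Finset ℕ :=
  Function.update A s (insert x (A s))

theorem msk_upd_ne (A : Fin 4 → Finset ℕ) (s : Fin 4) (x z : ℕ) (h : z ≠ x) :
    msk (upd A s x) z = msk A z := by
  unfold msk upd
  refine Finset.sum_congr rfl fun i _ => ?_
  by_cases hi : i = s
  · subst hi; simp [h]
  · simp [hi]

theorem msk_upd_self (A : Fin 4 → Finset ℕ) (s : Fin 4) (x : ℕ) (h : x ∉ A s) :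
    msk (upd A s x) x = msk A x + 2 ^ (s : ℕ) := by
  unfold msk upd
  rw [← Finset.add_sum_erase _ _ (Finset.mem_univ s), ← Finset.add_sum_erase (a := s) univ
    (fun i => if x ∈ A i then 2 ^ (i : ℕ) else 0) (Finset.mem_univ s)]
  simp only [Function.update_self, Finset.mem_insert, true_or, if_true, h, if_false, zero_add]
  rw [add_comm]
  congr 1
  refine Finset.sum_congr rfl fun i hi => ?_
  have : i ≠ s := (Finset.mem_erase.mp hi).1
  simp [this]

theorem cnt_upd (A : Fin 4 → Finset ℕ) (s : Fin 4) (x : ℕ) (h : x ∉ A s) (m : ℕ) (hm : m ≠ 0) :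
    cnt (upd A s x) m + (if msk A x = m then 1 else 0) =
      cnt A m + (if msk A x + 2 ^ (s : ℕ) = m then 1 else 0) := by
  have hx : x ∉ (univ.biUnion A).erase x := by simp
  rw [cnt_eq A m hm (insert x ((univ.biUnion A).erase x)),
    cnt_eq (upd A s x) m hm (insert x ((univ.biUnion A).erase x))]
  · rw [Finset.card_filter, Finset.card_filter, Finset.sum_insert hx, Finset.sum_insert hx,
      msk_upd_self A s x h]
    have : ∑ z ∈ (univ.biUnion A).erase x, (if msk (upd A s x) z = m then 1 else 0) =
        ∑ z ∈ (univ.biUnion A).erase x, (if msk A z = m then 1 else 0) := by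
      refine Finset.sum_congr rfl fun z hz => ?_
      rw [msk_upd_ne A s x z (Finset.mem_erase.mp hz).1]
    rw [this]; omega
  · intro z hz
    simp only [Finset.mem_biUnion, Finset.mem_univ, true_and, Finset.mem_insert,
      Finset.mem_erase] at hz ⊢
    obtain ⟨i, hi⟩ := hz
    by_cases hzx : z = x
    · exact Or.inl hzx
    · refine Or.inr ⟨hzx, i, ?_⟩
      unfold upd at hi
      by_cases his : i = s
      · subst his; simpa [hzx] using hi
      · simpa [his] using hi
  · intro z hz
    by_cases hzx : z = x
    · simp [hzx]
    · exact Finset.mem_insert_of_mem (Finset.mem_erase.mpr ⟨hzx, hz⟩)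

theorem cnt_pos (A : Fin 4 → Finset ℕ) (x : ℕ) (h : msk A x ≠ 0) : 1 ≤ cnt A (msk A x) := by
  rw [cnt_eq A _ h (insert x (univ.biUnion A)) (Finset.subset_insert _ _)]
  apply Finset.card_pos.mpr
  exact ⟨x, by simp⟩

theorem cnt_two (A : Fin 4 → Finset ℕ) (x y : ℕ) (hxy : x ≠ y) (h : msk A x ≠ 0)
    (he : msk A x = msk A y) : 2 ≤ cnt A (msk A x) := by
  rw [cnt_eq A _ h (insert x (insert y (univ.biUnion A)))
    ((Finset.subset_insert _ _).trans (Finset.subset_insert _ _))]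
  apply Finset.one_lt_card.mpr
  exact ⟨x, by simp, y, by simp [he], hxy⟩

theorem cnt_zero (A : Fin 4 → Finset ℕ) (m : ℕ) (h : ∀ z, msk A z ≠ m) : cnt A m = 0 := by
  unfold cnt
  rw [Finset.card_eq_zero, Finset.filter_eq_empty_iff]
  intro z _; exact h z

theorem cnt_one (A : Fin 4 → Finset ℕ) (x : ℕ) (hx : msk A x ≠ 0)
    (h : ∀ z, msk A z = msk A x → z = x) : cnt A (msk A x) = 1 := by
  refine le_antisymm ?_ (cnt_pos A x hx)
  unfold cnt
  apply Finset.card_le_one.mpr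
  intro a ha b hb
  rw [h a (Finset.mem_filter.mp ha).2, h b (Finset.mem_filter.mp hb).2]

/-- Relation between the counts before and after an element moves from mask `t` to `u`. -/
structure Rel (f f' : ℕ → ℕ) (t u : ℕ) : Prop where
  ht : t < 16
  hu : u < 16
  tu : t ≠ u
  off : ∀ m, m ≠ t → m ≠ u → f' m = f m
  U : ((u = 15 ∨ f u = 3) ∧ f' u = f u) ∨ (u ≠ 15 ∧ f u < 3 ∧ f' u = f u + 1)
  T : ((t = 0 ∨ f t = 3) ∧ f' t = f t) ∨ (t ≠ 0 ∧ f' t + 1 = f t)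

theorem code_split (f : ℕ → ℕ) (t u : ℕ) (ht : t < 16) (hu : u < 16) (h : t ≠ u) :
    code f = f t * 8 ^ t + f u * 8 ^ u + ∑ m ∈ ((range 16).erase t).erase u, f m * 8 ^ m := by
  unfold code
  rw [← Finset.add_sum_erase _ _ (Finset.mem_range.mpr ht),
    ← Finset.add_sum_erase ((range 16).erase t) _ (Finset.mem_erase.mpr ⟨h.symm, Finset.mem_range.mpr hu⟩)]
  omega

theorem Rel.code_eq {f f' : ℕ → ℕ} {t u : ℕ} (R : Rel f f' t u) :
    code f' + (f t * 8 ^ t + f u * 8 ^ u) = code f + (f' t * 8 ^ t + f' u * 8 ^ u) := by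
  rw [code_split f t u R.ht R.hu R.tu, code_split f' t u R.ht R.hu R.tu]
  have : ∑ m ∈ ((range 16).erase t).erase u, f' m * 8 ^ m =
      ∑ m ∈ ((range 16).erase t).erase u, f m * 8 ^ m := by
    refine Finset.sum_congr rfl fun m hm => ?_
    simp only [Finset.mem_erase] at hm
    rw [R.off m hm.2.1 hm.1]
  rw [this]; omega

theorem mem_tl (s : Fin 4) (t : ℕ) (ht : t < 16) (h : t.testBit s = false) :
    t ∈ tl s ∧ t + 2 ^ (s : ℕ) < 16 := by
  revert s t
  decide

theorem rel_upd (A : Fin 4 → Finset ℕ) (s : Fin 4) (x : ℕ) (h : x ∉ A s) :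
    Rel (fA A) (fA (upd A s x)) (msk A x) (msk A x + 2 ^ (s : ℕ)) := by
  have hb : (msk A x).testBit s = false := by rw [msk_bit]; simpa using h
  have hp : 0 < 2 ^ (s : ℕ) := by positivity
  have hl := mem_tl s _ (msk_lt A x) hb
  have hc := cnt_upd A s x h
  have hcp := cnt_pos A x
  generalize msk A x = t at *
  generalize 2 ^ (s : ℕ) = b at *
  refine ⟨by omega, hl.2, by omega, ?_, ?_, ?_⟩
  · intro m h1 h2
    unfold fA
    by_cases hm : m = 0
    · simp [hm]
    · have := hc m hm
      rw [if_neg (by omega), if_neg (by omega)] at this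
      simp only [add_zero] at this
      rw [this]
  · have := hc (t + b) (by omega)
    rw [if_neg (by omega), if_pos rfl] at this
    unfold fA
    split_ifs <;> omega
  · by_cases ht : t = 0
    · left; simp [ht, fA]
    · have := hc t ht
      have := hcp ht
      rw [if_pos rfl, if_neg (by omega)] at *
      unfold fA
      split_ifs <;> omega

theorem nbeq (a b : ℕ) : (Nat.beq a b = true) = (a = b) :=
  propext ⟨Nat.eq_of_beq_eq_true, fun h => by subst h; exact Nat.beq_refl a⟩

theorem nble (a b : ℕ) : (Nat.ble a b = true) = (a ≤ b) :=
  propext ⟨Nat.le_of_ble_eq_true, Nat.ble_eq_true_of_le⟩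

theorem succs_spec {f f' : ℕ → ℕ} {t u t2 : ℕ} (R : Rel f f' t u) (hf : ∀ m, f m ≤ 3)
    (k : ℕ → Bool) (h1 : t ≠ 0 → 1 ≤ f t) (h2 : t ≠ 0 → t = t2 → 2 ≤ f t)
    (h : succs (code f) t u t2 k = true) : k (code f') = true := by
  have hc := R.code_eq
  unfold succs at h
  simp only [frc_eq, dig_code f hf _ R.ht, dig_code f hf _ R.hu, Bool.cond_eq_ite, nbeq,
    Nat.add_eq, Nat.sub_eq, Nat.pow_eq] at h
  rw [if_pos (by
    split_ifs with g1 g2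
    · rfl
    · rw [nble]; exact h2 g1 g2
    · rw [nble]; exact h1 g1)] at h
  have hpow : ∀ a b : ℕ, (a + 1) * b = a * b + b := fun a b => by ring
  rcases R.U with ⟨hu, hu'⟩ | ⟨hu, hu3, hu'⟩
  · have e1 : (if u = 15 then code f else if f u = 3 then code f else code f + 8 ^ u) = code f := by
      rcases hu with hu | hu <;> simp [hu]
    rw [e1] at h
    rcases R.T with ⟨ht, ht'⟩ | ⟨ht, ht'⟩
    · have e2 : code f' = code f := by rw [hu', ht'] at hc; omega
      rw [e2]
      rcases ht with ht | ht
      · simpa [ht] using h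
      · split_ifs at h with h0
        · exact h
        · rw [Bool.and_eq_true] at h; exact h.2
    · have e2 : code f' = code f - 8 ^ t := by
        rw [hu', ← ht', hpow] at hc; omega
      rw [e2]
      rw [if_neg ht] at h
      simp only [Bool.and_eq_true] at h
      exact h.1
  · have e1 : (if u = 15 then code f else if f u = 3 then code f else code f + 8 ^ u)
        = code f + 8 ^ u := by
      rw [if_neg hu, if_neg (by omega)]
    rw [e1] at h
    rcases R.T with ⟨ht, ht'⟩ | ⟨ht, ht'⟩
    · have e2 : code f' = code f + 8 ^ u := by rw [hu', ht', hpow] at hc; omega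
      rw [e2]
      rcases ht with ht | ht
      · simpa [ht] using h
      · split_ifs at h with h0
        · exact h
        · rw [Bool.and_eq_true] at h; exact h.2
    · have e2 : code f' = code f + 8 ^ u - 8 ^ t := by
        rw [hu', ← ht', hpow, hpow] at hc; omega
      rw [e2]
      rw [if_neg ht] at h
      simp only [Bool.and_eq_true] at h
      exact h.1

theorem preds_spec {f f' : ℕ → ℕ} {t u : ℕ} (R : Rel f f' t u) (hf : ∀ m, f m ≤ 3)
    (hf' : ∀ m, f' m ≤ 3)
    (k : ℕ → Bool) (h : preds (code f') t u k = true) : k (code f) = true := by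
  have hc := R.code_eq
  unfold preds preds.predsB at h
  simp only [frc_eq, dig_code f' hf' _ R.ht, dig_code f' hf' _ R.hu, Bool.cond_eq_ite,
    nbeq, Nat.add_eq, Nat.sub_eq, Nat.pow_eq] at h
  have hpow : ∀ a b : ℕ, (a + 1) * b = a * b + b := fun a b => by ring
  have hft := hf t
  rcases R.U with ⟨hu, hu'⟩ | ⟨hu, hu3, hu'⟩
  · have h' : (if t = 0 then k (code f') else if f' t = 3 then k (code f')
        else k (code f' + 8 ^ t)) = true := by
      split_ifs at h ⊢ <;> simp_all
    rcases R.T with ⟨ht, ht'⟩ | ⟨ht, ht'⟩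
    · have e2 : code f = code f' := by rw [hu', ht'] at hc; omega
      rw [e2]
      rcases ht with ht | ht
      · simpa [ht] using h'
      · rw [ht', ht] at h'; simpa using h'
    · have e2 : code f = code f' + 8 ^ t := by
        rw [hu', ← ht', hpow] at hc; omega
      rw [e2]
      rw [if_neg ht, if_neg (by omega)] at h'
      exact h'
  · have h' : (if t = 0 then k (code f' - 8 ^ u) else if f' t = 3 then k (code f' - 8 ^ u)
        else k (code f' - 8 ^ u + 8 ^ t)) = true := by
      rw [if_neg hu] at h
      have : f' u ≠ 0 := by omega
      rw [if_neg this] at h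
      simp only [Bool.and_eq_true] at h
      exact h.2
    rcases R.T with ⟨ht, ht'⟩ | ⟨ht, ht'⟩
    · have e2 : code f = code f' - 8 ^ u := by rw [hu', ht', hpow] at hc; omega
      rw [e2]
      rcases ht with ht | ht
      · simpa [ht] using h'
      · rw [ht', ht] at h'; simpa using h'
    · have e2 : code f = code f' - 8 ^ u + 8 ^ t := by
        have hle : 8 ^ u ≤ code f' := by
          rw [code_split f' t u R.ht R.hu R.tu, hu', hpow]; omega
        rw [hu', ← ht', hpow, hpow] at hc; omega
      rw [e2]
      rw [if_neg ht, if_neg (by omega)] at h'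
      exact h'

theorem BLc_mem (a b r p q : ℕ) (T : Tr) (hr : T.mem r = true) (hp : p ≤ 3) (hq : q ≤ 3) :
    r + (p * 8 ^ a + q * 8 ^ b) ∈ BLc a b T := by
  unfold BLc
  simp only [List.mem_flatMap, List.mem_map]
  have key : ∀ p : ℕ, p ≤ 3 → p ∈ [0, 1, 2, 3] := by
    intro p hp
    simp only [List.mem_cons, List.not_mem_nil, or_false]
    omega
  refine ⟨r, Tr.mem_toList _ _ hr, p, key p hp, q, key q hq, ?_⟩
  simp only [Nat.add_eq, Nat.mul_eq, Nat.pow_eq]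

theorem isCh_mem (f : ℕ → ℕ) (hf : ∀ m, f m ≤ 3) (a b : ℕ) (ha : a < 16) (hb : b < 16) (T : Tr)
    (h : isCh (code f) a b T = true) : code f ∈ BLc a b T := by
  unfold isCh at h
  simp only [frc_eq, Bool.and_eq_true, nbeq] at h
  obtain ⟨_, h1, h2⟩ := h
  generalize hr : Nat.sub (code f) (rst (code f) a b) = r at *
  rw [h2]
  unfold rst
  rw [dig_code f hf a ha, dig_code f hf b hb]
  exact BLc_mem a b r _ _ T h1 (hf a) (hf b)

theorem bad_cases (f : ℕ → ℕ) (hf : ∀ m, f m ≤ 3) (h : bad (code f) = true) :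
    code f ∈ BL ∨ anyEq (code f) = true := by
  unfold bad anyCh isExc at h
  simp only [frc_eq, Bool.or_eq_true, Bool.and_eq_true] at h
  rcases h with (h | h) | h
  · left; unfold BL; simp only [List.mem_append]; exact Or.inl (Tr.mem_toList _ _ h.2)
  · left; unfold BL; simp only [List.mem_append]
    rcases h with ((h | h) | h) | h
    · exact Or.inr (Or.inl (isCh_mem f hf _ _ (by norm_num) (by norm_num) _ h))
    · exact Or.inr (Or.inr (Or.inl (isCh_mem f hf _ _ (by norm_num) (by norm_num) _ h)))
    · exact Or.inr (Or.inr (Or.inr (Or.inl (isCh_mem f hf _ _ (by norm_num) (by norm_num) _ h))))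
    · exact Or.inr (Or.inr (Or.inr (Or.inr (isCh_mem f hf _ _ (by norm_num) (by norm_num) _ h))))
  · exact Or.inr h

theorem isEq_iff (A : Fin 4 → Finset ℕ) (i j : Fin 4) (l : List ℕ)
    (hl : ∀ m < 16, m ∈ l ↔ m.testBit i ≠ m.testBit j) (hl' : ∀ m ∈ l, m < 16)
    (h0 : 0 ∉ l) (h15 : 15 ∉ l) :
    isEq (code (fA A)) l = true ↔ A i = A j := by
  unfold isEq
  simp only [List.all_eq_true, nbeq]
  constructor
  · intro h
    ext z
    by_contra hz
    have hm : msk A z ∈ l := by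
      rw [hl _ (msk_lt A z), msk_bit, msk_bit]
      intro hh
      rw [decide_eq_decide] at hh
      exact hz hh
    have h1 := h _ hm
    rw [dig_code _ (fA_le A) _ (msk_lt A z)] at h1
    have n0 : msk A z ≠ 0 := fun e => h0 (e ▸ hm)
    have n15 : msk A z ≠ 15 := fun e => h15 (e ▸ hm)
    have := cnt_pos A z n0
    unfold fA at h1
    rw [if_neg (by tauto)] at h1
    omega
  · intro h m hm
    rw [dig_code _ (fA_le A) _ (hl' m hm)]
    unfold fA
    rw [cnt_zero A m]
    · simp
    · intro z hz
      have := (hl m (hl' m hm)).1 hm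
      rw [← hz, msk_bit, msk_bit, h] at this
      exact this rfl

theorem anyEq_iff (A : Fin 4 → Finset ℕ) :
    anyEq (code (fA A)) = true ↔ ∃ i j, i ≠ j ∧ A i = A j := by
  unfold anyEq
  simp only [Bool.or_eq_true]
  rw [isEq_iff A 0 1 _ (by decide) (by decide) (by decide) (by decide),
    isEq_iff A 0 2 _ (by decide) (by decide) (by decide) (by decide),
    isEq_iff A 0 3 _ (by decide) (by decide) (by decide) (by decide),
    isEq_iff A 1 2 _ (by decide) (by decide) (by decide) (by decide),
    isEq_iff A 1 3 _ (by decide) (by decide) (by decide) (by decide),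
    isEq_iff A 2 3 _ (by decide) (by decide) (by decide) (by decide)]
  constructor
  · rintro (((((h | h) | h) | h) | h) | h)
    · exact ⟨0, 1, by decide, h⟩
    · exact ⟨0, 2, by decide, h⟩
    · exact ⟨0, 3, by decide, h⟩
    · exact ⟨1, 2, by decide, h⟩
    · exact ⟨1, 3, by decide, h⟩
    · exact ⟨2, 3, by decide, h⟩
  · rintro ⟨i, j, hij, h⟩
    fin_cases i <;> fin_cases j <;> simp at hij h <;> simp [h]

theorem bad_of_eq (A : Fin 4 → Finset ℕ) (i j : Fin 4) (hij : i ≠ j) (h : A i = A j) : Bad A := by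
  have := (anyEq_iff A).2 ⟨i, j, hij, h⟩
  unfold Bad bad
  simp [this]

/-- Codes for three rows `s, t, u` with `t = s + x`, `u = s + y`. -/
def chTest (t u v d e : ℕ) : Bool :=
  [0, 1, 2, 3].all fun p => [0, 1, 2, 3].all fun q =>
    anyCh (8 ^ (2 ^ t + d) + 8 ^ (2 ^ u + e) + (p * 8 ^ (2 ^ v) + q * 8 ^ (15 - 2 ^ v)))

theorem chTest_all : ∀ t u v : Fin 4, t ≠ u → t ≠ v → u ≠ v →
    chTest t u v 0 0 = true ∧ chTest t u v 0 (2 ^ (v : ℕ)) = true ∧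
    chTest t u v (2 ^ (v : ℕ)) 0 = true ∧ chTest t u v (2 ^ (v : ℕ)) (2 ^ (v : ℕ)) = true := by
  decide +kernel

theorem bits_aux0 : ∀ s t u v : Fin 4, s ≠ t → s ≠ u → s ≠ v → t ≠ u → t ≠ v → u ≠ v → ∀ m < 16,
    m.testBit s = false → m.testBit t = true → m.testBit u = false →
    m = 2 ^ (t : ℕ) + 0 ∨ m = 2 ^ (t : ℕ) + 2 ^ (v : ℕ) := by
  decide +kernel

theorem bits_aux : ∀ s t u v : Fin 4, s ≠ t → s ≠ u → s ≠ v → t ≠ u → t ≠ v → u ≠ v → ∀ m < 16,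
    m.testBit s = m.testBit t → m.testBit s = m.testBit u →
    m = 0 ∨ m = 15 ∨ m = 2 ^ (v : ℕ) ∨ m = 15 - 2 ^ (v : ℕ) := by
  decide +kernel

theorem bits_aux2 : ∀ s t u v : Fin 4, s ≠ t → s ≠ u → s ≠ v → t ≠ u → t ≠ v → u ≠ v →
    ∀ m, m = 2 ^ (v : ℕ) ∨ m = 15 - 2 ^ (v : ℕ) → 
    m.testBit s = m.testBit t ∧ m.testBit s = m.testBit u ∧ m ≠ 0 ∧ m ≠ 15 ∧ m < 16 ∧
      2 ^ (v : ℕ) ≠ 15 - 2 ^ (v : ℕ) := by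
  intro s t u v h1 h2 h3 h4 h5 h6 m hm
  rcases hm with rfl | rfl
  · revert s t u v; decide +kernel
  · revert s t u v; decide +kernel

theorem exists_fourth : ∀ s t u : Fin 4, ∃ v : Fin 4, s ≠ v ∧ t ≠ v ∧ u ≠ v := by decide

theorem bad_of_cherry (A : Fin 4 → Finset ℕ) (s t u : Fin 4) (hst : s ≠ t) (hsu : s ≠ u) (x y : ℕ)
    (hxy : x ≠ y) (hx : x ∉ A s) (hy : y ∉ A s) (ht : A t = insert x (A s))
    (hu : A u = insert y (A s)) : Bad A := by
  have htu : t ≠ u := by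
    rintro rfl
    have : x ∈ insert y (A s) := by rw [← hu, ht]; simp
    simp [hxy, hx] at this
  obtain ⟨v, hsv, htv, huv⟩ := exists_fourth s t u
  have hm := bits_aux s t u v hst hsu hsv htu htv huv
  have hm2 := bits_aux2 s t u v hst hsu hsv htu htv huv
  have bxs : (msk A x).testBit s = false := by rw [msk_bit]; simp [hx]
  have bxt : (msk A x).testBit t = true := by rw [msk_bit]; simp [ht]
  have bxu : (msk A x).testBit u = false := by rw [msk_bit]; simp [hu, hx, hxy]
  have bys : (msk A y).testBit s = false := by rw [msk_bit]; simp [hy]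
  have byt : (msk A y).testBit t = false := by rw [msk_bit]; simp [ht, hy, hxy.symm]
  have byu : (msk A y).testBit u = true := by rw [msk_bit]; simp [hu]
  have hother : ∀ z, z ≠ x → z ≠ y → (msk A z).testBit s = (msk A z).testBit t ∧
      (msk A z).testBit s = (msk A z).testBit u := by
    intro z h1 h2
    rw [msk_bit, msk_bit, msk_bit, ht, hu]
    simp [h1, h2]
  have x0 : msk A x ≠ 0 := by intro h; rw [h] at bxt; simp at bxt
  have y0 : msk A y ≠ 0 := by intro h; rw [h] at byu; simp at byu
  have b15 : ∀ s : Fin 4, (15 : ℕ).testBit s = true := by decide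
  have x15 : msk A x ≠ 15 := by intro h; rw [h, b15] at bxs; simp at bxs
  have y15 : msk A y ≠ 15 := by intro h; rw [h, b15] at bys; simp at bys
  have cx : cnt A (msk A x) = 1 := by
    apply cnt_one A x x0
    intro z hz
    by_contra hzx
    by_cases hzy : z = y
    · subst hzy; rw [hz, bxt] at byt; simp at byt
    · have := (hother z hzx hzy).1
      rw [hz, bxs, bxt] at this; simp at this
  have cy : cnt A (msk A y) = 1 := by
    apply cnt_one A y y0
    intro z hz
    by_contra hzy
    by_cases hzx : z = x
    · subst hzx; rw [hz, byu] at bxu; simp at bxu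
    · have := (hother z hzx hzy).2
      rw [hz, bys, byu] at this; simp at this
  obtain ⟨a1, a2, a3, a4, a5, a6⟩ := hm2 _ (Or.inl rfl)
  obtain ⟨c1, c2, c3, c4, c5, c6⟩ := hm2 _ (Or.inr rfl)
  set a := 2 ^ (v : ℕ) with ha
  set b := 15 - a with hb
  have xa : msk A x ≠ a := by intro h; rw [← h, bxs, bxt] at a1; simp at a1
  have xb : msk A x ≠ b := by intro h; rw [← h, bxs, bxt] at c1; simp at c1
  have ya : msk A y ≠ a := by intro h; rw [← h, bys, byu] at a2; simp at a2
  have yb : msk A y ≠ b := by intro h; rw [← h, bys, byu] at c2; simp at c2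
  have xy : msk A x ≠ msk A y := by intro h; rw [h, byt] at bxt; simp at bxt
  have key : code (fA A) = 8 ^ msk A x + 8 ^ msk A y + (fA A a * 8 ^ a + fA A b * 8 ^ b) := by
    have hf : ∀ m ∈ range 16, fA A m * 8 ^ m =
        (if m = msk A x then 8 ^ m else 0) + (if m = msk A y then 8 ^ m else 0) +
        ((if m = a then fA A m * 8 ^ m else 0) + (if m = b then fA A m * 8 ^ m else 0)) := by
      intro m hmr
      rw [Finset.mem_range] at hmr
      by_cases e1 : m = msk A x
      · rw [if_pos e1, if_neg (by omega), if_neg (by omega), if_neg (by omega)]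
        have : fA A m = 1 := by
          unfold fA; rw [if_neg (by omega), e1, cx]; rfl
        rw [this]; omega
      by_cases e2 : m = msk A y
      · rw [if_neg e1, if_pos e2, if_neg (by omega), if_neg (by omega)]
        have : fA A m = 1 := by
          unfold fA; rw [if_neg (by omega), e2, cy]; rfl
        rw [this]; omega
      rw [if_neg e1, if_neg e2]
      by_cases e3 : m = a
      · rw [if_pos e3, if_neg (by omega)]; omega
      by_cases e4 : m = b
      · rw [if_neg e3, if_pos e4]; omega
      rw [if_neg e3, if_neg e4]
      have : fA A m = 0 := by
        unfold fA
        split_ifs with h0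
        · rfl
        · rw [cnt_zero A m]
          · rfl
          · intro z hz
            by_cases hzx : z = x
            · subst hzx; omega
            by_cases hzy : z = y
            · subst hzy; omega
            have h1 := hother z hzx hzy
            rw [hz] at h1
            have := hm m hmr h1.1 h1.2
            omega
      rw [this]; omega
    unfold code
    rw [Finset.sum_congr rfl hf]
    simp only [Finset.sum_add_distrib, Finset.sum_ite_eq', Finset.mem_range, msk_lt, a5, c5, if_true]
  have ct : anyCh (code (fA A)) = true := by
    rw [key]
    have hex := bits_aux0 s t u v hst hsu hsv htu htv huv _ (msk_lt A x) bxs bxt bxu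
    have hey := bits_aux0 s u t v hsu hst hsv htu.symm huv htv _ (msk_lt A y) bys byu byt
    have l4 : ∀ p : ℕ, p ≤ 3 → p ∈ [0, 1, 2, 3] := by
      intro p hp
      simp only [List.mem_cons, List.not_mem_nil, or_false]
      omega
    have use : ∀ d e, chTest t u v d e = true →
        anyCh (8 ^ (2 ^ (t : ℕ) + d) + 8 ^ (2 ^ (u : ℕ) + e) +
          (fA A a * 8 ^ a + fA A b * 8 ^ b)) = true := by
      intro d e h
      unfold chTest at h
      exact List.all_eq_true.mp (List.all_eq_true.mp h _ (l4 _ (fA_le A a))) _ (l4 _ (fA_le A b))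
    obtain ⟨k1, k2, k3, k4⟩ := chTest_all t u v htu htv huv
    rcases hex with hex | hex <;> rcases hey with hey | hey <;> rw [hex, hey]
    · exact use _ _ k1
    · exact use _ _ k2
    · exact use _ _ k3
    · exact use _ _ k4
  unfold Bad bad
  simp [ct]

theorem chk_get (c : ℕ) (hc : c ∈ BL) (s : Fin 4) : chkP c (2 ^ (s : ℕ)) (tl s) = true := by
  have h := List.all_eq_true.mp chk_all c hc
  unfold chk at h
  simp only [frc_eq, Bool.and_eq_true] at h
  obtain ⟨h0, h1, h2, h3⟩ := h
  fin_cases s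
  · exact h0
  · exact h1
  · exact h2
  · exact h3

theorem fA_one (A : Fin 4 → Finset ℕ) (x : ℕ) (h0 : msk A x ≠ 0) (h15 : msk A x ≠ 15) :
    1 ≤ fA A (msk A x) := by
  have := cnt_pos A x h0
  unfold fA
  rw [if_neg (not_or.mpr ⟨h0, h15⟩)]
  omega

theorem fA_two (A : Fin 4 → Finset ℕ) (x y : ℕ) (hxy : x ≠ y) (h0 : msk A x ≠ 0)
    (h15 : msk A x ≠ 15) (he : msk A x = msk A y) : 2 ≤ fA A (msk A x) := by
  have := cnt_two A x y hxy h0 he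
  unfold fA
  rw [if_neg (not_or.mpr ⟨h0, h15⟩)]
  omega

theorem mem_tl_ne (s : Fin 4) (m : ℕ) (hm : m < 16) (h : m.testBit s = false) : m ≠ 15 := by
  rintro rfl
  have b15 : ∀ s : Fin 4, (15 : ℕ).testBit s = true := by decide
  rw [b15] at h
  cases h

theorem step_aux (A : Fin 4 → Finset ℕ) (s : Fin 4) (x y : ℕ) (hxy : x ≠ y) (hx : x ∉ A s)
    (hy : y ∉ A s) (h2 : code (fA (upd A s y)) ∈ BL) (h1 : Bad (upd A s x)) : Bad A := by
  by_contra hA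
  have bx : (msk A x).testBit s = false := by rw [msk_bit]; simp [hx]
  have bY : (msk A y).testBit s = false := by rw [msk_bit]; simp [hy]
  have h := chk_get _ h2 s
  unfold chkP at h
  have h := List.all_eq_true.mp h _ (mem_tl s _ (msk_lt A y) bY).1
  have h := preds_spec (rel_upd A s y hy) (fA_le _) (fA_le _) _ h
  rw [Bool.or_eq_true] at h
  rcases h with h | h
  · exact hA h
  · unfold chkS at h
    have h := List.all_eq_true.mp h _ (mem_tl s _ (msk_lt A x) bx).1
    have n15 := mem_tl_ne s _ (msk_lt A x) bx
    have h := succs_spec (rel_upd A s x hx) (fA_le _) _ (fun h0 => fA_one A x h0 n15)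
      (fun h0 he => fA_two A x y hxy h0 n15 he) h
    rw [frc_eq] at h
    unfold Bad at h1
    rw [h1] at h
    simp at h

theorem eq_upd (A : Fin 4 → Finset ℕ) (s : Fin 4) (x : ℕ) (hA : ¬ Bad A)
    (h : ∃ i j, i ≠ j ∧ upd A s x i = upd A s x j) : ∃ t, s ≠ t ∧ A t = insert x (A s) := by
  obtain ⟨i, j, hij, h⟩ := h
  unfold upd at h
  by_cases hi : i = s
  · subst hi
    refine ⟨j, hij, ?_⟩
    rw [Function.update_self, Function.update_of_ne hij.symm] at h
    exact h.symm
  · by_cases hj : j = s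
    · subst hj
      refine ⟨i, fun e => hij e.symm, ?_⟩
      rw [Function.update_self, Function.update_of_ne hij] at h
      exact h
    · rw [Function.update_of_ne hi, Function.update_of_ne hj] at h
      exact absurd (bad_of_eq A i j hij h) hA

theorem step (A : Fin 4 → Finset ℕ) (s : Fin 4) (x y : ℕ) (hxy : x ≠ y) (hx : x ∉ A s)
    (hy : y ∉ A s) (h1 : Bad (upd A s x)) (h2 : Bad (upd A s y)) : Bad A := by
  by_contra hA
  rcases bad_cases _ (fA_le _) h2 with g2 | g2
  · exact hA (step_aux A s x y hxy hx hy g2 h1)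
  rcases bad_cases _ (fA_le _) h1 with g1 | g1
  · exact hA (step_aux A s y x hxy.symm hy hx g1 h2)
  obtain ⟨t, hst, ht⟩ := eq_upd A s x hA ((anyEq_iff _).1 g1)
  obtain ⟨u, hsu, hu⟩ := eq_upd A s y hA ((anyEq_iff _).1 g2)
  exact hA (bad_of_cherry A s t u hst hsu x y hxy hx hy ht hu)

theorem choose_one (A : Fin 4 → Finset ℕ) (hA : ¬ Bad A) (s : Fin 4) (T : Finset ℕ)
    (hT : 2 ≤ T.card) : ∃ x ∈ T, ¬ Bad (upd A s x) := by
  obtain ⟨x, hx, y, hy, hxy⟩ := Finset.one_lt_card.mp hT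
  have hstay : ∀ z, z ∈ A s → upd A s z = A := by
    intro z hz
    unfold upd
    rw [Finset.insert_eq_of_mem hz, Function.update_eq_self]
  by_cases h1 : x ∈ A s
  · exact ⟨x, hx, by rw [hstay x h1]; exact hA⟩
  by_cases h2 : y ∈ A s
  · exact ⟨y, hy, by rw [hstay y h2]; exact hA⟩
  by_contra hcon
  push Not at hcon
  exact hA (step A s x y hxy h1 h2 (hcon x hx) (hcon y hy))

theorem choose_col (A : Fin 4 → Finset ℕ) (hA : ¬ Bad A) (T : Fin 4 → Finset ℕ)
    (hT : ∀ i, 2 ≤ (T i).card) :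
    ∃ x : Fin 4 → ℕ, (∀ i, x i ∈ T i) ∧ ¬ Bad (fun i => insert (x i) (A i)) := by
  obtain ⟨x0, m0, h0⟩ := choose_one A hA 0 _ (hT 0)
  obtain ⟨x1, m1, h1⟩ := choose_one _ h0 1 _ (hT 1)
  obtain ⟨x2, m2, h2⟩ := choose_one _ h1 2 _ (hT 2)
  obtain ⟨x3, m3, h3⟩ := choose_one _ h2 3 _ (hT 3)
  refine ⟨![x0, x1, x2, x3], ?_, ?_⟩
  · intro i; fin_cases i
    · exact m0
    · exact m1
    · exact m2
    · exact m3
  · have e : (fun i => insert (![x0, x1, x2, x3] i) (A i)) =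
        upd (upd (upd (upd A 0 x0) 1 x1) 2 x2) 3 x3 := by
      clear h0 h1 h2 h3 hA
      funext i
      fin_cases i <;> simp [upd]
    rw [e]
    exact h3

theorem injective_of_not_bad (A : Fin 4 → Finset ℕ) (hA : ¬ Bad A) (i j : Fin 4) (hij : i ≠ j) :
    A i ≠ A j := fun h => hA (bad_of_eq A i j hij h)

theorem card_row (A : Fin 4 → Finset ℕ) (i : Fin 4) :
    (A i).card = ∑ m ∈ range 16, if m.testBit i then cnt A m else 0 := by
  have hmap : ∀ z ∈ A i, msk A z ∈ range 16 := fun z _ => Finset.mem_range.mpr (msk_lt A z)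
  rw [Finset.card_eq_sum_card_fiberwise hmap]
  refine Finset.sum_congr rfl fun m _ => ?_
  split_ifs with hb
  · unfold cnt
    congr 1
    ext z
    simp only [Finset.mem_filter, Finset.mem_biUnion, Finset.mem_univ, true_and]
    constructor
    · rintro ⟨h1, h2⟩; exact ⟨⟨i, h1⟩, h2⟩
    · rintro ⟨_, h2⟩
      refine ⟨?_, h2⟩
      rw [← h2, msk_bit] at hb
      simpa using hb
  · rw [Finset.card_eq_zero, Finset.filter_eq_empty_iff]
    intro z hz h2
    apply hb
    rw [← h2, msk_bit]
    simpa using hz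

theorem rsum_eq (c i : ℕ) :
    rsum c i = ∑ m ∈ range 16, if m.testBit i then dig c m else 0 := by
  unfold rsum
  simp only [Bool.cond_eq_ite]
  rfl

theorem pairs_not_bad (A : Fin 4 → Finset ℕ) (hc : ∀ i, (A i).card = 2)
    (hd : ∀ i j, i ≠ j → A i ≠ A j) (hz : ∀ z, ∃ i, z ∉ A i) : ¬ Bad A := by
  intro hbad
  rcases bad_cases _ (fA_le _) hbad with h | h
  swap
  · obtain ⟨i, j, hij, h⟩ := (anyEq_iff A).1 h
    exact hd i j hij h
  have c15 : cnt A 15 = 0 := by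
    apply cnt_zero
    intro z hz15
    obtain ⟨i, hi⟩ := hz z
    have := msk_bit A z i
    rw [hz15] at this
    have b15 : ∀ s : Fin 4, (15 : ℕ).testBit s = true := by decide
    rw [b15] at this
    simp at this
    exact hi this
  have hrow : ∀ i : Fin 4, rsum (code (fA A)) i = 2 := by
    intro i
    have h1 := card_row A i
    rw [hc i] at h1
    have hle : ∀ m < 16, m.testBit i = true → cnt A m ≤ 2 := by
      intro m hm hb
      rw [h1]
      have := Finset.single_le_sum (f := fun m => if m.testBit i then cnt A m else 0)
        (fun _ _ => Nat.zero_le _) (Finset.mem_range.mpr hm)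
      simp only [hb, if_true] at this
      exact this
    rw [h1]
    rw [rsum_eq]
    refine Finset.sum_congr rfl fun m hm => ?_
    rw [Finset.mem_range] at hm
    by_cases hb : m.testBit i = true
    · have h2 := hle m hm hb
      have m0 : m ≠ 0 := by
        rintro rfl
        simp at hb
      rw [if_pos hb, if_pos hb, dig_code _ (fA_le A) _ hm]
      unfold fA
      split_ifs with h15
      · have : m = 15 := h15.resolve_left m0
        rw [this, c15]
      · omega
    · rw [if_neg hb, if_neg hb]
  have hs := List.all_eq_true.mp rsum_all _ h
  have r0 := hrow 0
  have r1 := hrow 1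
  have r2 := hrow 2
  have r3 := hrow 3
  simp only [Fin.val_zero, Fin.val_one, Fin.val_two] at r0 r1 r2
  change rsum _ 3 = 2 at r3
  rw [r0, r1, r2, r3] at hs
  simp only [Nat.beq_refl, Bool.and_self, Bool.not_true, Bool.false_or, nbeq] at hs
  rw [hs] at r0
  revert r0
  decide

theorem exists_avoid (S : Finset ℕ) (hS : S.card = 4) (a b c : ℕ) :
    ∃ x ∈ S, x ≠ a ∧ x ≠ b ∧ x ≠ c := by
  have h3 : ({a, b, c} : Finset ℕ).card ≤ 3 := Finset.card_le_three
  obtain ⟨x, hx, hn⟩ := Finset.exists_mem_notMem_of_card_lt_card (s := {a, b, c}) (t := S) (by omega)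
  refine ⟨x, hx, ?_⟩
  simpa using hn

theorem pw (P : Fin 4 → Fin 4 → Prop) (hs : ∀ i j, P i j → P j i) (h01 : P 0 1) (h02 : P 0 2)
    (h03 : P 0 3) (h12 : P 1 2) (h13 : P 1 3) (h23 : P 2 3) : ∀ i j, i ≠ j → P i j := by
  intro i j hij
  have hs01 := hs _ _ h01
  have hs02 := hs _ _ h02
  have hs03 := hs _ _ h03
  have hs12 := hs _ _ h12
  have hs13 := hs _ _ h13
  have hs23 := hs _ _ h23
  fin_cases i <;> fin_cases j <;> first | exact absurd rfl hij | assumption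

theorem init (S T : Fin 4 → Finset ℕ) (hS : ∀ i, (S i).card = 4) (hT : ∀ i, (T i).card = 4) :
    ∃ b c : Fin 4 → ℕ, (∀ i, b i ∈ S i) ∧ (∀ i, c i ∈ T i) ∧ (∀ i, b i ≠ c i) ∧
      (∀ i j, i ≠ j → b i ≠ b j) ∧ ¬ Bad (fun i => {b i, c i}) := by
  obtain ⟨b0, hb0, -⟩ := exists_avoid (S 0) (hS 0) 0 0 0
  obtain ⟨b1, hb1, h10, -⟩ := exists_avoid (S 1) (hS 1) b0 0 0
  obtain ⟨b2, hb2, h20, h21, -⟩ := exists_avoid (S 2) (hS 2) b0 b1 0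
  obtain ⟨b3, hb3, h30, h31, h32⟩ := exists_avoid (S 3) (hS 3) b0 b1 b2
  obtain ⟨c0, hc0, e00, e01, e02⟩ := exists_avoid (T 0) (hT 0) b0 b1 b2
  obtain ⟨c1, hc1, e11, e12, e13⟩ := exists_avoid (T 1) (hT 1) b1 b2 b3
  obtain ⟨c2, hc2, e22, e23, e2c⟩ := exists_avoid (T 2) (hT 2) b2 b3 c0
  obtain ⟨c3, hc3, e33, e30, -⟩ := exists_avoid (T 3) (hT 3) b3 b0 0
  refine ⟨![b0, b1, b2, b3], ![c0, c1, c2, c3], ?_, ?_, ?_, ?_, ?_⟩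
  · intro i; fin_cases i
    · exact hb0
    · exact hb1
    · exact hb2
    · exact hb3
  · intro i; fin_cases i
    · exact hc0
    · exact hc1
    · exact hc2
    · exact hc3
  · intro i; fin_cases i
    · exact e00.symm
    · exact e11.symm
    · exact e22.symm
    · exact e33.symm
  · exact pw _ (fun i j h => h.symm) h10.symm h20.symm h30.symm h21.symm h31.symm h32.symm
  · have key : ∀ a b c d : ℕ, ({a, b} : Finset ℕ) = {c, d} → a ≠ c → a = d ∧ b = c := by
      intro a b c d h hac
      have h1 : a ∈ ({c, d} : Finset ℕ) := by rw [← h]; simp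
      have h2 : c ∈ ({a, b} : Finset ℕ) := by rw [h]; simp
      simp only [Finset.mem_insert, Finset.mem_singleton] at h1 h2
      omega
    apply pairs_not_bad
    · intro i
      fin_cases i
      · exact Finset.card_pair e00.symm
      · exact Finset.card_pair e11.symm
      · exact Finset.card_pair e22.symm
      · exact Finset.card_pair e33.symm
    · refine pw _ (fun i j h => h.symm) ?_ ?_ ?_ ?_ ?_ ?_
      · exact fun h => e01 (key b0 c0 b1 c1 h h10.symm).2
      · exact fun h => e02 (key b0 c0 b2 c2 h h20.symm).2
      · exact fun h => e30 (key b0 c0 b3 c3 h h30.symm).1.symm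
      · exact fun h => e12 (key b1 c1 b2 c2 h h21.symm).2
      · exact fun h => e13 (key b1 c1 b3 c3 h h31.symm).2
      · exact fun h => e23 (key b2 c2 b3 c3 h h32.symm).2
    · intro z
      by_contra hcon
      push Not at hcon
      have z0 : z ∈ ({b0, c0} : Finset ℕ) := hcon 0
      have z1 : z ∈ ({b1, c1} : Finset ℕ) := hcon 1
      have z2 : z ∈ ({b2, c2} : Finset ℕ) := hcon 2
      have z3 : z ∈ ({b3, c3} : Finset ℕ) := hcon 3
      simp only [Finset.mem_insert, Finset.mem_singleton] at z0 z1 z2 z3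
      clear hcon hS hT key
      omega

end GF

open GF in
/-- main theorem: For n = 3, k = 4, every family of 4-element sets
S_{ij} ⊆ ℕ admits an assignment a_{ij} ∈ S_{ij} satisfying (2a), (2b), (3). -/
theorem stmt5 (S : Fin 4 → ℕ → Finset ℕ)
    (hS : ∀ i, ∀ j : ℕ, 1 ≤ j → (S i j).card = 4) :
    ∃ a : Fin 4 → ℕ → ℕ,
      (∀ i, ∀ j : ℕ, 1 ≤ j → a i j ∈ S i j) ∧
      (∀ i, a i 1 ≠ a i 2 ∧ a i 1 ≠ a i 3 ∧ a i 2 ≠ a i 3) ∧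
      (∀ i, ∀ j : ℕ, 3 ≤ j → a i j ≠ a i 1 ∧ a i j ≠ a i 2) ∧
      (∀ r₁ r₂, r₁ ≠ r₂ → ∀ j : ℕ, 1 ≤ j →
        (Finset.Icc 1 j).image (a r₁) ≠ (Finset.Icc 1 j).image (a r₂)) := by
  obtain ⟨b, c, hb, hc, hbc, hbb, hbad⟩ := GF.init (fun i => S i 1) (fun i => S i 2)
    (fun i => hS i 1 le_rfl) (fun i => hS i 2 (by norm_num))
  have hT : ∀ n i, 2 ≤ (S i (n + 3) \ {b i, c i}).card := by
    intro n i
    have h1 := Finset.le_card_sdiff {b i, c i} (S i (n + 3))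
    have h2 : ({b i, c i} : Finset ℕ).card ≤ 2 := Finset.card_le_two
    rw [hS i (n + 3) (by omega)] at h1
    omega
  choose nx nx1 nx2 using fun (A : {A : Fin 4 → Finset ℕ // ¬ Bad A}) (n : ℕ) =>
    choose_col A.1 A.2 (fun i => S i (n + 3) \ {b i, c i}) (hT n)
  let st : ℕ → {A : Fin 4 → Finset ℕ // ¬ Bad A} := fun n =>
    Nat.rec ⟨fun i => {b i, c i}, hbad⟩ (fun n A => ⟨_, nx2 A n⟩) n
  have st0 : (st 0).1 = fun i => {b i, c i} := rfl
  have stS : ∀ n, (st (n + 1)).1 = fun i => insert (nx (st n) n i) ((st n).1 i) := fun n => rfl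
  let a : Fin 4 → ℕ → ℕ := fun i j =>
    match j with
    | 0 => 0
    | 1 => b i
    | 2 => c i
    | n + 3 => nx (st n) n i
  have a1 : ∀ i, a i 1 = b i := fun i => rfl
  have a2 : ∀ i, a i 2 = c i := fun i => rfl
  have a3 : ∀ i n, a i (n + 3) = nx (st n) n i := fun i n => rfl
  have hmem : ∀ i n, a i (n + 3) ∈ S i (n + 3) ∧ a i (n + 3) ≠ b i ∧ a i (n + 3) ≠ c i := by
    intro i n
    have := nx1 (st n) n i
    rw [a3]
    simpa using this
  have himg : ∀ n i, (Finset.Icc 1 (n + 2)).image (a i) = (st n).1 i := by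
    intro n i
    induction n with
    | zero =>
      rw [st0]
      have : Finset.Icc 1 (0 + 2) = {1, 2} := by decide
      rw [this, Finset.image_insert, Finset.image_singleton, a1, a2]
    | succ n ih =>
      rw [stS]
      change _ = insert (nx (st n) n i) ((st n).1 i)
      rw [← ih, ← a3]
      have : Finset.Icc 1 (n + 1 + 2) = insert (n + 3) (Finset.Icc 1 (n + 2)) := by
        ext z; simp only [Finset.mem_Icc, Finset.mem_insert]; omega
      rw [this, Finset.image_insert]
  refine ⟨a, ?_, ?_, ?_, ?_⟩
  · intro i j hj
    match j, hj with
    | 1, _ => exact hb i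
    | 2, _ => exact hc i
    | n + 3, _ => exact (hmem i n).1
  · intro i
    exact ⟨hbc i, (hmem i 0).2.1.symm, (hmem i 0).2.2.symm⟩
  · intro i j hj
    obtain ⟨n, rfl⟩ := Nat.exists_eq_add_of_le' hj
    exact (hmem i n).2
  · intro r₁ r₂ hr j hj
    match j, hj with
    | 1, _ =>
      simp only [Finset.Icc_self, Finset.image_singleton, a1]
      intro h
      exact hbb r₁ r₂ hr (Finset.singleton_injective h)
    | n + 2, _ =>
      rw [himg, himg]
      exact injective_of_not_bad _ (st n).2 r₁ r₂ hr
end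

section
/- For all n ≥ 1 and all k ≥ 2n − 1, the grid-filling problem has a general solution: for every family of sets S_{ij} ⊆ ℕ with |S_{ij}| = k (i = 1,…,k; j ∈ ℕ), there exist a_{ij} ∈ S_{ij} satisfying conditions (2a), (2b), (3). -/
open Finset in
/-- `Y` is an upper cover of `X`. -/
def GP (X Y : Finset ℕ) : Prop := X ⊆ Y ∧ Y.card = X.card + 1

open Classical in
/-- the rows covering `X`. -/
noncomputable def gcov {k : ℕ} (A : Fin k → Finset ℕ) (X : Finset ℕ) : Finset (Fin k) :=
  Finset.univ.filter (fun r => GP X (A r))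

theorem mem_gcov {k : ℕ} (A : Fin k → Finset ℕ) (X : Finset ℕ) (r : Fin k) :
    r ∈ gcov A X ↔ GP X (A r) := by
  simp [gcov]

theorem GP_union {X X' Y : Finset ℕ} (h : GP X Y) (h' : GP X' Y) (hne : X ≠ X') :
    Y = X ∪ X' := by
  symm
  apply Finset.eq_of_subset_of_card_le (Finset.union_subset h.1 h'.1)
  by_contra hlt
  have hc : X.card = X'.card := by have := h.2; have := h'.2; omega
  have h1 : X = X ∪ X' := Finset.eq_of_subset_of_card_le Finset.subset_union_left
    (by have := h.2; omega)
  have h2 : X' = X ∪ X' := Finset.eq_of_subset_of_card_le Finset.subset_union_right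
    (by have := h'.2; omega)
  exact hne (h1.trans h2.symm)

/-- candidate sets -/
def gcand (A T : Finset ℕ) : Finset (Finset ℕ) :=
  if (T ∩ A).Nonempty then {A} else T.image (fun a => insert a A)

theorem gcand_stay {A T : Finset ℕ} (h : (T ∩ A).Nonempty) : gcand A T = {A} := by
  simp [gcand, h]

theorem gcand_stuck_card {A T : Finset ℕ} (h : ¬ (T ∩ A).Nonempty) :
    (gcand A T).card = T.card := by
  rw [gcand, if_neg h]
  apply Finset.card_image_of_injOn
  intro a ha b hb hab
  have h' : ∀ x ∈ T, x ∉ A := fun x hx hA => h ⟨x, Finset.mem_inter.2 ⟨hx, hA⟩⟩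
  have : a ∈ insert b A := by
    have hab' : insert a A = insert b A := hab
    rw [← hab']; exact Finset.mem_insert_self _ _
  rcases Finset.mem_insert.1 this with h1 | h1
  · exact h1
  · exact absurd h1 (h' a ha)

theorem gcand_stuck_GP {A T Y : Finset ℕ} (h : ¬ (T ∩ A).Nonempty) (hY : Y ∈ gcand A T) :
    GP A Y := by
  rw [gcand, if_neg h] at hY
  obtain ⟨a, ha, rfl⟩ := Finset.mem_image.1 hY
  have h' : a ∉ A := fun hA => h ⟨a, Finset.mem_inter.2 ⟨ha, hA⟩⟩
  exact ⟨Finset.subset_insert _ _, Finset.card_insert_of_notMem h'⟩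

theorem gcand_exists {A T Y : Finset ℕ} (hY : Y ∈ gcand A T) : ∃ a ∈ T, Y = insert a A := by
  by_cases h : (T ∩ A).Nonempty
  · rw [gcand_stay h] at hY
    obtain ⟨a, ha⟩ := h
    rw [Finset.mem_inter] at ha
    refine ⟨a, ha.1, ?_⟩
    rw [Finset.insert_eq_of_mem ha.2]; simpa using hY
  · rw [gcand, if_neg h] at hY
    obtain ⟨a, ha, rfl⟩ := Finset.mem_image.1 hY
    exact ⟨a, ha, rfl⟩

theorem hall_step {k t : ℕ} (hkt : k + 1 ≤ 2 * t) (A T : Fin k → Finset ℕ)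
    (hA : Function.Injective A) (hc : ∀ i, (gcov A (A i)).card + 1 ≤ t)
    (hT : ∀ i, t ≤ (T i).card) :
    ∃ B : Fin k → Finset ℕ, Function.Injective B ∧ ∀ i, B i ∈ gcand (A i) (T i) := by
  classical
  rw [← Finset.all_card_le_biUnion_card_iff_exists_injective (fun i => gcand (A i) (T i))]
  intro s
  by_cases h0 : ∃ i ∈ s, ¬ (T i ∩ A i).Nonempty
  · obtain ⟨i, his, hi⟩ := h0
    have ci := gcand_stuck_card hi
    have hTi := hT i
    by_cases h1 : ∃ r ∈ s, r ≠ i ∧ ¬ (T r ∩ A r).Nonempty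
    · obtain ⟨r, hrs, hri, hr⟩ := h1
      have cr := gcand_stuck_card hr
      have hTr := hT r
      have hsub : gcand (A i) (T i) ∪ gcand (A r) (T r) ⊆
          s.biUnion (fun i => gcand (A i) (T i)) :=
        Finset.union_subset (Finset.subset_biUnion_of_mem (fun i => gcand (A i) (T i)) his)
          (Finset.subset_biUnion_of_mem (fun i => gcand (A i) (T i)) hrs)
      have h2 := Finset.card_le_card hsub
      have h3 := Finset.card_union_add_card_inter (gcand (A i) (T i)) (gcand (A r) (T r))
      have h4 : (gcand (A i) (T i) ∩ gcand (A r) (T r)).card ≤ 1 := by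
        rw [Finset.card_le_one]
        intro x hx y hy
        rw [Finset.mem_inter] at hx hy
        have hne : A i ≠ A r := fun h => hri (hA h.symm)
        rw [GP_union (gcand_stuck_GP hi hx.1) (gcand_stuck_GP hr hx.2) hne,
          GP_union (gcand_stuck_GP hi hy.1) (gcand_stuck_GP hr hy.2) hne]
      have h5 : s.card ≤ k := by simpa using Finset.card_le_univ s
      omega
    · push Not at h1
      have hsub : gcand (A i) (T i) ∪ (s.erase i).image A ⊆
          s.biUnion (fun i => gcand (A i) (T i)) := by
        refine Finset.union_subset
          (Finset.subset_biUnion_of_mem (fun i => gcand (A i) (T i)) his) ?_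
        intro x hx
        obtain ⟨r, hr, rfl⟩ := Finset.mem_image.1 hx
        rw [Finset.mem_erase] at hr
        refine Finset.mem_biUnion.2 ⟨r, hr.2, ?_⟩
        rw [gcand_stay (h1 r hr.2 hr.1)]; simp
      have h2 := Finset.card_le_card hsub
      have h3 := Finset.card_union_add_card_inter (gcand (A i) (T i)) ((s.erase i).image A)
      have h4 : (gcand (A i) (T i) ∩ (s.erase i).image A).card ≤ (gcov A (A i)).card := by
        rw [← Finset.card_image_of_injective (gcov A (A i)) hA]
        apply Finset.card_le_card
        intro x hx
        rw [Finset.mem_inter] at hx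
        obtain ⟨r, hr, rfl⟩ := Finset.mem_image.1 hx.2
        exact Finset.mem_image_of_mem _ ((mem_gcov _ _ _).2 (gcand_stuck_GP hi hx.1))
      have h5 := Finset.card_image_of_injective (s.erase i) hA
      have h6 := Finset.card_erase_add_one his
      have h7 := hc i
      omega
  · push Not at h0
    rw [← Finset.card_image_of_injective s hA]
    apply Finset.card_le_card
    intro x hx
    obtain ⟨r, hr, rfl⟩ := Finset.mem_image.1 hx
    refine Finset.mem_biUnion.2 ⟨r, hr, ?_⟩
    rw [gcand_stay (h0 r hr)]; simp

/-- two distinct sets share at most one covering row. -/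
theorem gcov_inter {k : ℕ} (B : Fin k → Finset ℕ) (hB : Function.Injective B)
    {X Z : Finset ℕ} (h : X ≠ Z) : (gcov B X ∩ gcov B Z).card ≤ 1 := by
  classical
  rw [Finset.card_le_one]
  intro x hx y hy
  rw [Finset.mem_inter, mem_gcov, mem_gcov] at hx hy
  apply hB
  rw [GP_union hx.1 hx.2 h, GP_union hy.1 hy.2 h]

theorem update_inj {k : ℕ} (B : Fin k → Finset ℕ) (hB : Function.Injective B) (m : Fin k)
    (Y : Finset ℕ) (hY : ∀ r, r ≠ m → B r ≠ Y) : Function.Injective (Function.update B m Y) := by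
  intro a b hab
  by_cases ha : a = m <;> by_cases hb : b = m
  · rw [ha, hb]
  · subst ha; simp [Function.update_of_ne hb] at hab; exact absurd hab.symm (hY b hb)
  · subst hb; simp [Function.update_of_ne ha] at hab; exact absurd hab (hY a ha)
  · simp [Function.update_of_ne ha, Function.update_of_ne hb] at hab; exact hB hab

theorem improve {k t p : ℕ} (hkt : k + 1 ≤ 2 * t) (A T : Fin k → Finset ℕ)
    (hA : Function.Injective A) (hc : ∀ i, (gcov A (A i)).card + 1 ≤ t)
    (hT : ∀ i, t ≤ (T i).card) (hp : t ≤ p + 1)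
    (B : Fin k → Finset ℕ) (hB : Function.Injective B)
    (hBc : ∀ i, B i ∈ gcand (A i) (T i))
    (hcB : ∀ i, (gcov B (B i)).card ≤ p + 1) :
    ∃ B : Fin k → Finset ℕ, Function.Injective B ∧ (∀ i, B i ∈ gcand (A i) (T i)) ∧
      ∀ i, (gcov B (B i)).card ≤ p := by
  classical
  by_cases hbad : ∃ i, p < (gcov B (B i)).card
  swap
  · push Not at hbad
    exact ⟨B, hB, hBc, hbad⟩
  obtain ⟨i, hi⟩ := hbad
  obtain ⟨W, hW⟩ : ∃ W, W = gcov B (B i) := ⟨_, rfl⟩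
  obtain ⟨Q, hQ⟩ : ∃ Q, Q = (Finset.univ \ W).erase i := ⟨_, rfl⟩
  have hWc : W.card = p + 1 := by have := hcB i; rw [hW]; omega
  have hiW : i ∉ W := by
    rw [hW, mem_gcov]; intro h; have := h.2; omega
  have hQc : Q.card + p + 2 = k := by
    have h1 := Finset.card_sdiff_add_card_eq_card (Finset.subset_univ W)
    have h2 := Finset.card_erase_add_one (s := Finset.univ \ W) (a := i) (by simp [hiW])
    rw [← hQ] at h2
    simp only [Finset.card_univ, Fintype.card_fin] at h1
    omega
  have htri : ∀ r, r = i ∨ r ∈ W ∨ r ∈ Q := by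
    intro r; rw [hQ]; simp; tauto
  have hWP : ∀ r, r ∈ W ↔ GP (B i) (B r) := by intro r; rw [hW, mem_gcov]
  -- choosing a free candidate
  have hfree : ∀ m, ¬ (T m ∩ A m).Nonempty →
      ∃ Y ∈ gcand (A m) (T m), Y ≠ B m ∧ ∀ r ∈ Q, B r ≠ Y := by
    intro m hm
    have h1 : ((insert m Q).image B).card < (gcand (A m) (T m)).card := by
      have h2 := Finset.card_image_le (s := insert m Q) (f := B)
      have h3 := Finset.card_insert_le m Q
      rw [gcand_stuck_card hm]
      have := hT m
      omega
    obtain ⟨Y, hY, hY'⟩ := Finset.exists_mem_notMem_of_card_lt_card h1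
    refine ⟨Y, hY, ?_, ?_⟩
    · rintro rfl; exact hY' (Finset.mem_image_of_mem _ (Finset.mem_insert_self _ _))
    · rintro r hr rfl
      exact hY' (Finset.mem_image_of_mem _ (Finset.mem_insert_of_mem hr))
  have hcand : ∀ m Y, Y ∈ gcand (A m) (T m) →
      ∀ i, Function.update B m Y i ∈ gcand (A i) (T i) := by
    intro m Y hY r
    by_cases h : r = m
    · subst h; simpa using hY
    · rw [Function.update_of_ne h]; exact hBc r
  -- rows in Q stay good after any update
  have hQgood : ∀ m Y, (∀ r, r = i → r ≠ m → True) → ∀ q ∈ Q, q ≠ m →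
      (m = i ∨ (m ∈ W ∧ Y.card = (B i).card + 1)) →
      (gcov (Function.update B m Y) (B q)).card ≤ p := by
    intro m Y _ q hq hqm hm
    have hqi : q ≠ i := by rw [hQ] at hq; exact (Finset.mem_erase.1 hq).1
    have hne : B i ≠ B q := fun h => hqi (hB h).symm
    have hQ1 := Finset.card_erase_add_one hq
    have key : gcov (Function.update B m Y) (B q) ⊆
        (Q.erase q ∪ {m}) ∪ (gcov B (B i) ∩ gcov B (B q)) ∨
        gcov (Function.update B m Y) (B q) ⊆ Q.erase q ∪ {i} := by
      by_cases hX : GP (B q) (B i) ∧ m ≠ i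
      · right
        intro r hr
        rw [mem_gcov] at hr
        have hmW := hm.resolve_left hX.2
        by_cases hrm : r = m
        · subst hrm
          rw [Function.update_self] at hr
          have := hr.2; have := hX.1.2; have := hmW.2; omega
        · rw [Function.update_of_ne hrm] at hr
          rcases htri r with h | h | h
          · simp [h]
          · have := ((hWP r).1 h).2; have := hr.2; have := hX.1.2; omega
          · have : r ≠ q := by rintro rfl; have := hr.2; omega
            simp [h, this]
      · left
        intro r hr
        rw [mem_gcov] at hr
        by_cases hrm : r = m
        · simp [hrm]
        · rw [Function.update_of_ne hrm] at hr
          rcases htri r with h | h | h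
          · subst h
            exact absurd ⟨hr, fun h => hrm h.symm⟩ hX
          · rw [hW] at h
            exact Finset.mem_union_right _ (Finset.mem_inter.2 ⟨h, (mem_gcov _ _ _).2 hr⟩)
          · have : r ≠ q := by rintro rfl; have := hr.2; omega
            simp [h, this]
    have h1 := gcov_inter B hB hne
    rcases key with h | h
    · have h2 := Finset.card_le_card h
      have h3 := Finset.card_union_le (Q.erase q ∪ {m}) (gcov B (B i) ∩ gcov B (B q))
      have h4 := Finset.card_union_le (Q.erase q) {m}
      rw [Finset.card_singleton] at h4
      omega
    · have h2 := Finset.card_le_card h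
      have h4 := Finset.card_union_le (Q.erase q) {i}
      rw [Finset.card_singleton] at h4
      omega
  -- sets of size one more than that of row i are fine
  have hWgood : ∀ m Y Z, (m = i ∨ m ∈ W) → Y.card ≤ (B i).card + 1 →
      Z.card = (B i).card + 1 → (gcov (Function.update B m Y) Z).card ≤ p := by
    intro m Y Z hm hY hZ
    have key : gcov (Function.update B m Y) Z ⊆ Q := by
      intro r hr
      rw [mem_gcov] at hr
      by_cases hrm : r = m
      · subst hrm
        rw [Function.update_self] at hr
        have := hr.2; omega
      · rw [Function.update_of_ne hrm] at hr
        rcases htri r with h | h | h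
        · subst h; have := hr.2; omega
        · have := ((hWP r).1 h).2; have := hr.2; omega
        · exact h
    have := Finset.card_le_card key
    omega
  by_cases hst : (T i ∩ A i).Nonempty
  · -- row i stays, some covering row is stuck
    have hBi : B i = A i := by have := hBc i; rw [gcand_stay hst] at this; simpa using this
    have : ∃ m ∈ W, ¬ (T m ∩ A m).Nonempty := by
      by_contra hcon
      push Not at hcon
      have hsub : W ⊆ gcov A (A i) := by
        intro r hr
        have hBr : B r = A r := by
          have := hBc r; rw [gcand_stay (hcon r hr)] at this; simpa using this
        rw [mem_gcov, ← hBi, ← hBr]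
        exact (hWP r).1 hr
      have := Finset.card_le_card hsub
      have := hc i
      omega
    obtain ⟨m, hmW, hm⟩ := this
    obtain ⟨Y, hY, hYm, hYQ⟩ := hfree m hm
    have hmi : m ≠ i := fun h => hiW (h ▸ hmW)
    have hPm := (hWP m).1 hmW
    have hGm := gcand_stuck_GP hm (hBc m)
    have hGY := gcand_stuck_GP hm hY
    have hYc : Y.card = (B i).card + 1 := by
      have := hPm.2; have := hGm.2; have := hGY.2; omega
    have hneA : B i ≠ A m := by rw [hBi]; exact fun h => hmi (hA h).symm
    have hnP : ¬ GP (B i) Y := by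
      intro h
      apply hYm
      rw [GP_union h hGY hneA, GP_union hPm hGm hneA]
    refine ⟨Function.update B m Y, update_inj B hB m Y ?_, hcand m Y hY, ?_⟩
    · intro r hr heq
      rcases htri r with h | h | h
      · subst h; rw [heq] at hYc; omega
      · apply hnP; rw [← heq]; exact (hWP r).1 h
      · exact hYQ r h heq
    · intro r
      by_cases hrm : r = m
      · subst hrm
        rw [Function.update_self]
        exact hWgood r Y Y (Or.inr hmW) hYc.le hYc
      · rw [Function.update_of_ne hrm]
        rcases htri r with h | h | h
        · subst h
          have key : gcov (Function.update B m Y) (B r) ⊆ W.erase m := by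
            intro x hx
            rw [mem_gcov] at hx
            by_cases hxm : x = m
            · subst hxm; rw [Function.update_self] at hx; exact absurd hx hnP
            · rw [Function.update_of_ne hxm] at hx
              exact Finset.mem_erase.2 ⟨hxm, (hWP x).2 hx⟩
          have h1 := Finset.card_le_card key
          have h2 := Finset.card_erase_add_one hmW
          omega
        · exact hWgood m Y _ (Or.inr hmW) hYc.le ((hWP r).1 h).2
        · exact hQgood m Y (fun _ _ _ => trivial) r h hrm (Or.inr ⟨hmW, hYc⟩)
  · -- row i is stuck
    obtain ⟨Y, hY, hYm, hYQ⟩ := hfree i hst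
    have hGm := gcand_stuck_GP hst (hBc i)
    have hGY := gcand_stuck_GP hst hY
    have hYc : Y.card = (B i).card := by
      have := hGm.2; have := hGY.2; omega
    refine ⟨Function.update B i Y, update_inj B hB i Y ?_, hcand i Y hY, ?_⟩
    · intro r hr heq
      rcases htri r with h | h | h
      · exact hr h
      · have := ((hWP r).1 h).2; rw [heq] at this; omega
      · exact hYQ r h heq
    · intro r
      by_cases hrm : r = i
      · subst hrm
        rw [Function.update_self]
        have key : gcov (Function.update B r Y) Y ⊆ Q ∪ (gcov B (B r) ∩ gcov B Y) := by
          intro x hx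
          rw [mem_gcov] at hx
          by_cases hxm : x = r
          · subst hxm; rw [Function.update_self] at hx; have := hx.2; omega
          · rw [Function.update_of_ne hxm] at hx
            rcases htri x with h | h | h
            · exact absurd h hxm
            · rw [hW] at h
              exact Finset.mem_union_right _ (Finset.mem_inter.2 ⟨h, (mem_gcov _ _ _).2 hx⟩)
            · exact Finset.mem_union_left _ h
        have h1 := Finset.card_le_card key
        have h2 := Finset.card_union_le Q (gcov B (B r) ∩ gcov B Y)
        have h3 := gcov_inter B hB hYm.symm
        omega
      · rw [Function.update_of_ne hrm]
        rcases htri r with h | h | h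
        · exact absurd h hrm
        · exact hWgood i Y _ (Or.inl rfl) (by omega) ((hWP r).1 h).2
        · exact hQgood i Y (fun _ _ _ => trivial) r h hrm (Or.inl rfl)

theorem full_step {k t : ℕ} (hkt : k + 1 ≤ 2 * t) (A T : Fin k → Finset ℕ)
    (hA : Function.Injective A) (hc : ∀ i, (gcov A (A i)).card + 1 ≤ t)
    (hT : ∀ i, t ≤ (T i).card) :
    ∃ a : Fin k → ℕ, (∀ i, a i ∈ T i) ∧ Function.Injective (fun i => insert (a i) (A i)) ∧
      ∀ i, (gcov (fun i => insert (a i) (A i)) (insert (a i) (A i))).card + 1 ≤ t := by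
  have main : ∀ d, ∃ B : Fin k → Finset ℕ, Function.Injective B ∧
      (∀ i, B i ∈ gcand (A i) (T i)) ∧ ∀ i, (gcov B (B i)).card ≤ (t - 1) + (k - d) := by
    intro d
    induction d with
    | zero =>
      obtain ⟨B, h1, h2⟩ := hall_step hkt A T hA hc hT
      refine ⟨B, h1, h2, fun i => ?_⟩
      have : (gcov B (B i)).card ≤ k := by simpa using Finset.card_le_univ (gcov B (B i))
      omega
    | succ d ih =>
      obtain ⟨B, h1, h2, h3⟩ := ih
      by_cases hd : d < k
      · exact improve (p := (t - 1) + (k - (d + 1))) hkt A T hA hc hT (by omega) B h1 h2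
          (fun i => (h3 i).trans (by omega))
      · exact ⟨B, h1, h2, fun i => (h3 i).trans (by omega)⟩
  obtain ⟨B, h1, h2, h3⟩ := main k
  choose a ha hBa using fun i => gcand_exists (h2 i)
  have hfun : B = fun i => insert (a i) (A i) := funext hBa
  refine ⟨a, ha, hfun ▸ h1, fun i => ?_⟩
  have := h3 i
  rw [← hfun, ← hBa i]
  omega

/-- good partial filling up to column `j`. -/
def GGood (n k : ℕ) (S : Fin k → ℕ → Finset ℕ) (j : ℕ) (g : Fin k → ℕ → ℕ) : Prop :=
  (∀ i l, 1 ≤ l → l ≤ j → g i l ∈ S i l) ∧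
  (∀ i l l', 1 ≤ l' → l' < l → l ≤ j → l' ≤ n - 1 → g i l ≠ g i l') ∧
  Function.Injective (fun i => (Finset.Icc 1 j).image (g i)) ∧
  ∀ i, (gcov (fun i => (Finset.Icc 1 j).image (g i)) ((Finset.Icc 1 j).image (g i))).card + 1
    ≤ k - (n - 1)

theorem ggood_one (n k : ℕ) (hn : 1 ≤ n) (hk : 2 * n - 1 ≤ k)
    (S : Fin k → ℕ → Finset ℕ)
    (hS : ∀ i, ∀ j : ℕ, 1 ≤ j → (S i j).card = k) : ∃ g, GGood n k S 1 g := by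
  classical
  have hall : ∃ f : Fin k → ℕ, Function.Injective f ∧ ∀ i, f i ∈ S i 1 := by
    rw [← Finset.all_card_le_biUnion_card_iff_exists_injective (fun i => S i 1)]
    intro s
    rcases s.eq_empty_or_nonempty with rfl | ⟨i, hi⟩
    · simp
    · have h1 := Finset.card_le_card (Finset.subset_biUnion_of_mem (fun i => S i 1) hi)
      have h2 : s.card ≤ k := by simpa using Finset.card_le_univ s
      have h3 := hS i 1 le_rfl
      omega
  obtain ⟨f, hf, hfS⟩ := hall
  refine ⟨fun i _ => f i, ?_, ?_, ?_, ?_⟩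
  · intro i l h1 h2
    obtain rfl : l = 1 := by omega
    exact hfS i
  · intro i l l' h1 h2 h3; omega
  · intro a b hab
    apply hf
    simpa using hab
  · intro i
    have : gcov (fun i => (Finset.Icc 1 1).image (fun _ : ℕ => f i))
        ((Finset.Icc 1 1).image (fun _ : ℕ => f i)) = ∅ := by
      apply Finset.eq_empty_of_forall_notMem
      intro r hr
      rw [mem_gcov] at hr
      have := hr.2
      simp at this
    rw [this]
    simp
    omega

theorem ggood_succ (n k : ℕ) (hn : 1 ≤ n) (hk : 2 * n - 1 ≤ k)
    (S : Fin k → ℕ → Finset ℕ)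
    (hS : ∀ i, ∀ j : ℕ, 1 ≤ j → (S i j).card = k) (j : ℕ) (g : Fin k → ℕ → ℕ)
    (hg : GGood n k S j g) :
    ∃ g', GGood n k S (j + 1) g' ∧ ∀ i, ∀ l ≤ j, g' i l = g i l := by
  classical
  obtain ⟨h1, h2, h3, h4⟩ := hg
  obtain ⟨a, ha, hinj, hcov⟩ := full_step (t := k - (n - 1)) (by omega)
    (fun i => (Finset.Icc 1 j).image (g i))
    (fun i => S i (j + 1) \ (Finset.Icc 1 (min j (n - 1))).image (g i)) h3 h4 (by
      intro i
      have e1 := Finset.le_card_sdiff ((Finset.Icc 1 (min j (n - 1))).image (g i)) (S i (j + 1))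
      have e2 := Finset.card_image_le (s := Finset.Icc 1 (min j (n - 1))) (f := g i)
      rw [Nat.card_Icc] at e2
      have e3 := hS i (j + 1) (by omega)
      have e4 : min j (n - 1) ≤ n - 1 := min_le_right _ _
      omega)
  have hold : ∀ i, ∀ l ≤ j, Function.update (g i) (j + 1) (a i) l = g i l := by
    intro i l hl
    exact Function.update_of_ne (by omega) _ _
  have himg : ∀ i, (Finset.Icc 1 (j + 1)).image (Function.update (g i) (j + 1) (a i)) =
      insert (a i) ((Finset.Icc 1 j).image (g i)) := by
    intro i
    rw [← Finset.insert_Icc_right_eq_Icc_add_one (by omega), Finset.image_insert,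
      Function.update_self]
    congr 1
    apply Finset.image_congr
    intro l hl
    exact hold i l (by simp at hl; exact hl.2)
  refine ⟨fun i => Function.update (g i) (j + 1) (a i), ⟨?_, ?_, ?_, ?_⟩, hold⟩
  · intro i l hl hl'
    rcases Nat.lt_or_ge j l with h | h
    · obtain rfl : l = j + 1 := by omega
      simp only [Function.update_self]
      exact (Finset.mem_sdiff.1 (ha i)).1
    · simp only [hold i l h]; exact h1 i l hl h
  · intro i l l' hl' hll hl hn'
    simp only [hold i l' (by omega)]
    rcases Nat.lt_or_ge j l with h | h
    · obtain rfl : l = j + 1 := by omega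
      simp only [Function.update_self]
      intro heq
      apply (Finset.mem_sdiff.1 (ha i)).2
      rw [heq]
      apply Finset.mem_image_of_mem
      rw [Finset.mem_Icc]
      exact ⟨hl', le_min (by omega) hn'⟩
    · simp only [hold i l h]; exact h2 i l l' hl' hll h hn'
  · simp only [himg]; exact hinj
  · simp only [himg]; exact hcov

/-- For all n ≥ 1 and k ≥ 2n − 1, the grid-filling problem has a
general solution. -/
theorem stmt9 (n k : ℕ) (hn : 1 ≤ n) (hk : 2 * n - 1 ≤ k)
    (S : Fin k → ℕ → Finset ℕ)
    (hS : ∀ i, ∀ j : ℕ, 1 ≤ j → (S i j).card = k) :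
    ∃ a : Fin k → ℕ → ℕ,
      (∀ i, ∀ j : ℕ, 1 ≤ j → a i j ∈ S i j) ∧
      (∀ i, ∀ j₁ j₂ : ℕ, 1 ≤ j₁ → j₁ < j₂ → j₂ ≤ n → a i j₁ ≠ a i j₂) ∧
      (∀ i, ∀ j : ℕ, n ≤ j → ∀ j' : ℕ, 1 ≤ j' → j' ≤ n - 1 → a i j ≠ a i j') ∧
      (∀ r₁ r₂, r₁ ≠ r₂ → ∀ j : ℕ, 1 ≤ j →
        (Finset.Icc 1 j).image (a r₁) ≠ (Finset.Icc 1 j).image (a r₂)) := by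
  classical
  obtain ⟨g0, hg0⟩ := ggood_one n k hn hk S hS
  choose nx hnx hag using ggood_succ n k hn hk S hS
  let G : (j : ℕ) → {g // GGood n k S (j + 1) g} := fun j =>
    Nat.rec (motive := fun j => {g // GGood n k S (j + 1) g}) ⟨g0, hg0⟩
      (fun j g => ⟨nx (j + 1) g.1 g.2, hnx (j + 1) g.1 g.2⟩) j
  have hG : ∀ j i, ∀ l ≤ j + 1, (G (j + 1)).1 i l = (G j).1 i l := fun j =>
    hag (j + 1) (G j).1 (G j).2
  have hG2 : ∀ j d i, ∀ l ≤ j + 1, (G (j + d)).1 i l = (G j).1 i l := by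
    intro j d
    induction d with
    | zero => intro i l _; rfl
    | succ d ih =>
      intro i l hl
      rw [← ih i l hl]
      exact hG (j + d) i l (by omega)
  have hG3 : ∀ j i, ∀ l ≤ j + 1, (G l).1 i l = (G j).1 i l := by
    intro j i l hl
    rcases Nat.le_total l j with h | h
    · obtain ⟨d, rfl⟩ := Nat.exists_eq_add_of_le h
      exact (hG2 l d i l (by omega)).symm
    · obtain ⟨d, rfl⟩ := Nat.exists_eq_add_of_le h
      exact hG2 j d i _ hl
  have hdist : ∀ i l l', 1 ≤ l' → l' < l → l' ≤ n - 1 → (G l).1 i l ≠ (G l').1 i l' := by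
    intro i l l' h1 h2 h3
    rw [hG3 l i l' (by omega)]
    exact (G l).2.2.1 i l l' h1 h2 (by omega) h3
  refine ⟨fun i l => (G l).1 i l, ?_, ?_, ?_, ?_⟩
  · intro i j hj
    exact (G j).2.1 i j hj (by omega)
  · intro i j₁ j₂ h1 h2 h3
    exact (hdist i j₂ j₁ h1 h2 (by omega)).symm
  · intro i j h1 j' h2 h3
    exact hdist i j j' h2 (by omega) h3
  · intro r₁ r₂ hr j hj heq
    obtain ⟨m, rfl⟩ : ∃ m, j = m + 1 := ⟨j - 1, by omega⟩
    have himg : ∀ r, (Finset.Icc 1 (m + 1)).image (fun l => (G l).1 r l) =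
        (Finset.Icc 1 (m + 1)).image ((G m).1 r) := by
      intro r
      apply Finset.image_congr
      intro l hl
      exact hG3 m r l (by simp at hl; exact hl.2)
    rw [himg, himg] at heq
    exact hr ((G m).2.2.2.1 heq)
end
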